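/- Gaussian complexity bound for the constrained error cone: Let f and g be norms on ℝ^n and ℝ^m, x* ∈ ℝ^n, v* ∈ ℝ^m, and let C₁(x*,v*) := {(a,b) ∈ ℝ^n × ℝ^m : a ∈ T_f(x*) and b ∈ T_g(v*)}. Then γ(C₁(x*,v*) ∩ S^{n+m−1}) ≤ 2 [ ω(T_f(x*) ∩ S^{n−1}) + ω(T_g(v*) ∩ S^{m−1}) + 1 ]. -/

import Mathlib

open MeasureTheory ProbabilityTheory

noncomputable section

/-- Squared Euclidean norm of a vector in `ι → ℝ`. -/
def sqNorm {ι : Type*} [Fintype ι] (x : ι → ℝ) : ℝ := ∑ i, (x i) ^ 2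

/-- Euclidean norm of a vector in `ι → ℝ`. -/
def eNorm {ι : Type*} [Fintype ι] (x : ι → ℝ) : ℝ := Real.sqrt (sqNorm x)

/-- Euclidean inner product. -/
def dotp {ι : Type*} [Fintype ι] (x y : ι → ℝ) : ℝ := ∑ i, x i * y i

/-- Sub-Gaussian (ψ₂, Orlicz) norm of a real random variable. -/
def psi2Norm {Ω : Type*} [MeasurableSpace Ω] (μ : Measure Ω) (X : Ω → ℝ) : ℝ :=
  sInf {K : ℝ | 0 < K ∧ ∫ ω, Real.exp ((X ω) ^ 2 / K ^ 2) ∂μ ≤ 2}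

/-- Sub-Gaussian (ψ₂) norm of a random vector: supremum of ψ₂ norms of its
one-dimensional marginals over the unit sphere. -/
def vecPsi2Norm {Ω : Type*} [MeasurableSpace Ω] {ι : Type*} [Fintype ι]
    (μ : Measure Ω) (X : Ω → ι → ℝ) : ℝ :=
  sSup {c : ℝ | ∃ y : ι → ℝ, sqNorm y = 1 ∧ c = psi2Norm μ (fun ω => dotp (X ω) y)}

/-- A random vector is centered if each coordinate has zero mean. -/
def IsCentered {Ω : Type*} [MeasurableSpace Ω] {ι : Type*} [Fintype ι]
    (μ : Measure Ω) (X : Ω → ι → ℝ) : Prop :=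
  ∀ i, ∫ ω, X ω i ∂μ = 0

/-- A random vector is isotropic if its second moment matrix is the identity. -/
def IsIsotropic {Ω : Type*} [MeasurableSpace Ω] {ι : Type*} [Fintype ι] [DecidableEq ι]
    (μ : Measure Ω) (X : Ω → ι → ℝ) : Prop :=
  ∀ i j, ∫ ω, X ω i * X ω j ∂μ = if i = j then (1 : ℝ) else 0

/-- Standard Gaussian measure on `ι → ℝ`. -/
def stdGaussian (ι : Type*) [Fintype ι] : Measure (ι → ℝ) :=
  Measure.pi fun _ => gaussianReal 0 1

/-- Gaussian complexity `γ(T) = E sup_{x ∈ T} |⟨g, x⟩|`. -/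
def gaussComplexity {ι : Type*} [Fintype ι] (T : Set (ι → ℝ)) : ℝ :=
  ∫ g, sSup ((fun x => |dotp g x|) '' T) ∂(stdGaussian ι)

/-- Gaussian width `ω(T) = E sup_{x ∈ T} ⟨g, x⟩`. -/
def gaussWidth {ι : Type*} [Fintype ι] (T : Set (ι → ℝ)) : ℝ :=
  ∫ g, sSup ((fun x => dotp g x) '' T) ∂(stdGaussian ι)

/-- Gaussian squared distance `η²(T) = E inf_{u ∈ T} ‖g - u‖₂²`. -/
def gaussSqDist {ι : Type*} [Fintype ι] (T : Set (ι → ℝ)) : ℝ :=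
  ∫ g, sInf ((fun u => sqNorm (g - u)) '' T) ∂(stdGaussian ι)

/-- Radius `rad(T) = sup_{x ∈ T} ‖x‖₂`. -/
def radius {ι : Type*} [Fintype ι] (T : Set (ι → ℝ)) : ℝ :=
  sSup (eNorm '' T)

/-- Euclidean boundedness of a set. -/
def EBounded {ι : Type*} [Fintype ι] (T : Set (ι → ℝ)) : Prop :=
  ∃ R : ℝ, ∀ x ∈ T, eNorm x ≤ R

/-- Unit Euclidean sphere in `ι → ℝ`. -/
def unitSphere (ι : Type*) [Fintype ι] : Set (ι → ℝ) := {x | sqNorm x = 1}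

/-- Identify a pair `(a, b) ∈ ℝ^n × ℝ^m` with the concatenated vector in `ℝ^{n+m}`. -/
def pairVec {n m : ℕ} (p : (Fin n → ℝ) × (Fin m → ℝ)) : (Fin n ⊕ Fin m) → ℝ :=
  Sum.elim p.1 p.2

/-- Image of a set of pairs under concatenation. -/
def pairSet {n m : ℕ} (T : Set ((Fin n → ℝ) × (Fin m → ℝ))) : Set ((Fin n ⊕ Fin m) → ℝ) :=
  pairVec '' T

/-- Intersection of a set of pairs (viewed in `ℝ^{n+m}`) with the unit sphere. -/
def sphPair {n m : ℕ} (T : Set ((Fin n → ℝ) × (Fin m → ℝ))) : Set ((Fin n ⊕ Fin m) → ℝ) :=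
  pairSet T ∩ unitSphere (Fin n ⊕ Fin m)

/-- The extended map `(a, b) ↦ A a + √m · b`. -/
def extMap {m n : ℕ} (A : Matrix (Fin m) (Fin n) ℝ) (p : (Fin n → ℝ) × (Fin m → ℝ)) :
    Fin m → ℝ :=
  A.mulVec p.1 + Real.sqrt m • p.2

/-- Euclidean norm of a pair, `√(‖a‖₂² + ‖b‖₂²)`. -/
def pairNorm {n m : ℕ} (p : (Fin n → ℝ) × (Fin m → ℝ)) : ℝ :=
  Real.sqrt (sqNorm p.1 + sqNorm p.2)

/-- `f` is a norm on `ι → ℝ`. -/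
structure IsNorm {ι : Type*} [Fintype ι] (f : (ι → ℝ) → ℝ) : Prop where
  eq_zero_iff : ∀ x, f x = 0 ↔ x = 0
  smul : ∀ (c : ℝ) (x), f (c • x) = |c| * f x
  triangle : ∀ x y, f (x + y) ≤ f x + f y

/-- Tangent cone (cone of descent directions) of `f` at `x`. -/
def tangentCone' {ι : Type*} [Fintype ι] (f : (ι → ℝ) → ℝ) (x : ι → ℝ) : Set (ι → ℝ) :=
  {u | ∃ t : ℝ, 0 < t ∧ f (x + t • u) ≤ f x}

/-- Subdifferential of `f` at `x`. -/
def subdiff {ι : Type*} [Fintype ι] (f : (ι → ℝ) → ℝ) (x : ι → ℝ) : Set (ι → ℝ) :=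
  {u | ∀ d, f x + dotp u d ≤ f (x + d)}

/-- Dual norm `f*(d) = sup {⟨u, d⟩ : f(u) ≤ 1}`. -/
def dualNorm {ι : Type*} [Fintype ι] (f : (ι → ℝ) → ℝ) (d : ι → ℝ) : ℝ :=
  sSup ((fun u => dotp u d) '' {u | f u ≤ 1})

/-- Compatibility constant `α_f = sup_{u ≠ 0} f(u)/‖u‖₂`. -/
def compatConst {ι : Type*} [Fintype ι] (f : (ι → ℝ) → ℝ) : ℝ :=
  sSup ((fun u => f u / eNorm u) '' {u | u ≠ 0})

end

noncomputable section

/-- Operator (ℓ₂ → ℓ₂) norm of a square matrix. -/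
def opNorm {n : ℕ} (M : Matrix (Fin n) (Fin n) ℝ) : ℝ :=
  sSup ((fun x => eNorm (M.mulVec x)) '' {x : Fin n → ℝ | eNorm x ≤ 1})

end
section GaussianSup

variable {ι : Type*} [Fintype ι]

instance : IsProbabilityMeasure (stdGaussian ι) := by
  unfold _root_.stdGaussian; infer_instance

theorem dotp_neg_left (g x : ι → ℝ) : dotp (-g) x = -dotp g x := by
  simp [dotp]

theorem dotp_smul_right (c : ℝ) (g x : ι → ℝ) : dotp g (c • x) = c * dotp g x := by
  simp only [dotp, Pi.smul_apply, smul_eq_mul, Finset.mul_sum]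
  exact Finset.sum_congr rfl fun i _ => by ring

theorem sqNorm_smul (c : ℝ) (x : ι → ℝ) : sqNorm (c • x) = c ^ 2 * sqNorm x := by
  simp [sqNorm, mul_pow, Finset.mul_sum]

theorem sqNorm_nonneg (x : ι → ℝ) : 0 ≤ sqNorm x :=
  Finset.sum_nonneg fun i _ => sq_nonneg (x i)

theorem continuous_dotp_left (x : ι → ℝ) : Continuous fun g : ι → ℝ => dotp g x := by
  unfold dotp; fun_prop

theorem abs_dotp_le_sum_abs {x : ι → ℝ} (hx : x ∈ unitSphere ι) (g : ι → ℝ) :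
    |dotp g x| ≤ ∑ i, |g i| := by
  refine (Finset.abs_sum_le_sum_abs _ _).trans (Finset.sum_le_sum fun i _ => ?_)
  have hxi : |x i| ≤ 1 := by
    rw [abs_le_one_iff_mul_self_le_one, ← sq]
    calc (x i) ^ 2 ≤ sqNorm x :=
          Finset.single_le_sum (f := fun i => (x i) ^ 2) (fun j _ => sq_nonneg _)
            (Finset.mem_univ i)
      _ = 1 := hx
  rw [abs_mul]
  exact mul_le_of_le_one_right (abs_nonneg _) hxi

theorem measurePreserving_neg_stdGaussian :
    MeasurePreserving (fun g : ι → ℝ => -g) (stdGaussian ι) (stdGaussian ι) := by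
  refine measurePreserving_pi (fun _ : ι => gaussianReal 0 1) (fun _ => gaussianReal 0 1)
    (f := fun _ (x : ℝ) => -x) fun _ => ⟨measurable_neg, ?_⟩
  have h := gaussianReal_map_neg (μ := 0) (v := 1)
  rwa [neg_zero] at h

theorem memLp_eval_stdGaussian (i : ι) :
    MemLp (fun g : ι → ℝ => g i) 2 (stdGaussian ι) :=
  (memLp_id_gaussianReal (μ := 0) (v := 1) 2).comp_measurePreserving
    (measurePreserving_eval (fun _ : ι => gaussianReal 0 1) i)

theorem integrable_sum_abs_stdGaussian :
    Integrable (fun g : ι → ℝ => ∑ i, |g i|) (stdGaussian ι) :=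
  integrable_finsetSum _ fun i _ => ((memLp_eval_stdGaussian i).integrable one_le_two).abs

theorem memLp_dotp_stdGaussian (x : ι → ℝ) :
    MemLp (fun g : ι → ℝ => dotp g x) 2 (stdGaussian ι) :=
  memLp_finsetSum _ fun i _ => (memLp_eval_stdGaussian i).mul_const (x i)

theorem integral_dotp_stdGaussian (x : ι → ℝ) :
    ∫ g, dotp g x ∂(stdGaussian ι) = 0 := by
  have h : ∫ g, dotp (-g) x ∂(stdGaussian ι) = ∫ g, dotp g x ∂(stdGaussian ι) :=
    measurePreserving_neg_stdGaussian.integral_comp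
      (MeasurableEquiv.neg (ι → ℝ)).measurableEmbedding fun g => dotp g x
  simp only [dotp_neg_left, integral_neg] at h
  linarith

theorem integral_dotp_sq_stdGaussian (x : ι → ℝ) :
    ∫ g, (dotp g x) ^ 2 ∂(stdGaussian ι) = sqNorm x := by
  have hsum : (∑ i, fun g : ι → ℝ => g i * x i) = fun g => dotp g x := by
    ext g; simp [dotp]
  have hvar := variance_sum_pi (μ := fun _ : ι => gaussianReal 0 1)
    (X := fun i t => t * x i)
    fun i => (memLp_id_gaussianReal (μ := 0) (v := 1) 2).mul_const (x i)
  rw [hsum] at hvar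
  have hmean := integral_dotp_stdGaussian x
  have hmem := memLp_dotp_stdGaussian x
  rw [_root_.stdGaussian] at hmean hmem ⊢
  rw [variance_of_integral_eq_zero hmem.aemeasurable hmean] at hvar
  rw [hvar, sqNorm]
  refine Finset.sum_congr rfl fun i _ => ?_
  rw [variance_mul_const]
  have := variance_fun_id_gaussianReal (μ := 0) (v := 1)
  simp [this]

theorem integral_abs_dotp_le_one {x : ι → ℝ} (hx : x ∈ unitSphere ι) :
    ∫ g, |dotp g x| ∂(stdGaussian ι) ≤ 1 := by
  have hmem := memLp_dotp_stdGaussian x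
  have hint : Integrable (fun g : ι → ℝ => (1 + (dotp g x) ^ 2) / 2) (stdGaussian ι) :=
    ((integrable_const 1).add hmem.integrable_sq).div_const 2
  calc ∫ g, |dotp g x| ∂(stdGaussian ι)
      ≤ ∫ g, (1 + (dotp g x) ^ 2) / 2 ∂(stdGaussian ι) := by
        refine integral_mono (hmem.integrable one_le_two).abs hint fun g => ?_
        have := sq_nonneg (|dotp g x| - 1)
        have := sq_abs (dotp g x)
        simp only
        nlinarith
    _ = 1 := by
        rw [integral_div, integral_add (integrable_const 1) hmem.integrable_sq,
          integral_dotp_sq_stdGaussian, show sqNorm x = 1 from hx]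
        simp

theorem bddAbove_dotp_image {T : Set (ι → ℝ)} (hT : T ⊆ unitSphere ι) (g : ι → ℝ) :
    BddAbove ((fun x => dotp g x) '' T) := by
  refine ⟨∑ i, |g i|, ?_⟩
  rintro _ ⟨x, hx, rfl⟩
  exact (le_abs_self _).trans (abs_dotp_le_sum_abs (hT hx) g)

theorem integrable_sSup_dotp {T : Set (ι → ℝ)} (hT : T ⊆ unitSphere ι) :
    Integrable (fun g => sSup ((fun x => dotp g x) '' T)) (stdGaussian ι) := by
  rcases T.eq_empty_or_nonempty with rfl | ⟨y, hy⟩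
  · simp
  refine integrable_sum_abs_stdGaussian.mono' ?_ (Filter.Eventually.of_forall fun g => ?_)
  · refine Measurable.aestronglyMeasurable (LowerSemicontinuous.measurable ?_)
    simp only [sSup_image']
    refine lowerSemicontinuous_ciSup (fun g => ?_) fun x =>
      (continuous_dotp_left (x : ι → ℝ)).lowerSemicontinuous
    have h := bddAbove_dotp_image hT g
    rwa [Set.image_eq_range] at h
  · rw [Real.norm_eq_abs, abs_le]
    constructor
    · exact (abs_le.1 (abs_dotp_le_sum_abs (hT hy) g)).1.trans
        (le_csSup (bddAbove_dotp_image hT g) ⟨y, hy, rfl⟩)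
    · refine csSup_le ⟨_, y, hy, rfl⟩ ?_
      rintro _ ⟨x, hx, rfl⟩
      exact (le_abs_self _).trans (abs_dotp_le_sum_abs (hT hx) g)

/-- The linear functionals indexed by a subset `T` of the unit sphere have a common nonnegative
integrable envelope with mean at most `2 ω(T) + 1`. -/
theorem exists_envelope_abs_dotp {T : Set (ι → ℝ)} (hT : T ⊆ unitSphere ι) :
    ∃ G : (ι → ℝ) → ℝ, Integrable G (stdGaussian ι) ∧ (∀ g, 0 ≤ G g) ∧
      (∀ g, ∀ x ∈ T, |dotp g x| ≤ G g) ∧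
      ∫ g, G g ∂(stdGaussian ι) ≤ 2 * gaussWidth T + 1 := by
  rcases T.eq_empty_or_nonempty with rfl | ⟨y, hy⟩
  · exact ⟨0, integrable_zero _ _ _, fun _ => le_rfl, by simp, by simp [gaussWidth]⟩
  let S : (ι → ℝ) → ℝ := fun g => sSup ((fun x => dotp g x) '' T)
  have hS : Integrable S (stdGaussian ι) := integrable_sSup_dotp hT
  have hSneg : Integrable (fun g => S (-g)) (stdGaussian ι) :=
    measurePreserving_neg_stdGaussian.integrable_comp_of_integrable hS
  have hsum : Integrable (fun g => S g + S (-g)) (stdGaussian ι) := hS.add hSneg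
  have hy_int : Integrable (fun g => |dotp g y|) (stdGaussian ι) :=
    ((memLp_dotp_stdGaussian y).integrable one_le_two).abs
  have hle : ∀ g, ∀ x ∈ T, dotp g x ≤ S g := fun g x hx =>
    le_csSup (bddAbove_dotp_image hT g) ⟨x, hx, rfl⟩
  have hle_neg : ∀ g, ∀ x ∈ T, -dotp g x ≤ S (-g) := fun g x hx =>
    dotp_neg_left g x ▸ hle (-g) x hx
  have hbound : ∀ g, ∀ x ∈ T, |dotp g x| ≤ S g + S (-g) + |dotp g y| := fun g x hx => by
    have := hle g x hx
    have := hle_neg g x hx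
    have := hle g y hy
    have := hle_neg g y hy
    have := neg_abs_le (dotp g y)
    have := le_abs_self (dotp g y)
    rw [abs_le]
    constructor <;> linarith
  refine ⟨fun g => S g + S (-g) + |dotp g y|, hsum.add hy_int,
    fun g => (abs_nonneg _).trans (hbound g y hy), hbound, ?_⟩
  have hSneg_eq : ∫ g, S (-g) ∂(stdGaussian ι) = ∫ g, S g ∂(stdGaussian ι) :=
    measurePreserving_neg_stdGaussian.integral_comp
      (MeasurableEquiv.neg (ι → ℝ)).measurableEmbedding S
  rw [integral_add hsum hy_int, integral_add hS hSneg, hSneg_eq]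
  have hwidth : ∫ g, S g ∂(stdGaussian ι) = gaussWidth T := rfl
  have := integral_abs_dotp_le_one (hT hy)
  linarith

theorem smul_mem_tangentCone' {f : (ι → ℝ) → ℝ} {x u : ι → ℝ} (hu : u ∈ tangentCone' f x)
    {c : ℝ} (hc : 0 < c) : c • u ∈ tangentCone' f x := by
  obtain ⟨t, ht, h⟩ := hu
  refine ⟨t / c, div_pos ht hc, ?_⟩
  rw [smul_smul, div_mul_cancel₀ _ hc.ne']
  exact h

/-- A bound for `|⟨g, ·⟩|` on the spherical part of a tangent cone extends to its part in the
unit ball. -/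
theorem abs_dotp_le_of_mem_tangentCone' {f : (ι → ℝ) → ℝ} {x g : ι → ℝ} {B : ℝ} (hB : 0 ≤ B)
    (h : ∀ u ∈ tangentCone' f x ∩ unitSphere ι, |dotp g u| ≤ B)
    {a : ι → ℝ} (ha : a ∈ tangentCone' f x) (ha1 : sqNorm a ≤ 1) : |dotp g a| ≤ B := by
  rcases (sqNorm_nonneg a).eq_or_lt with h0 | hpos
  · have hz : ∀ i, a i = 0 := fun i => by
      have := (Finset.sum_eq_zero_iff_of_nonneg fun i _ => sq_nonneg (a i)).1 h0.symm i
        (Finset.mem_univ i)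
      exact pow_eq_zero_iff two_ne_zero |>.1 this
    simpa [dotp, hz] using hB
  · have hr : 0 < √(sqNorm a) := Real.sqrt_pos.2 hpos
    have hr1 : √(sqNorm a) ≤ 1 := Real.sqrt_le_one.2 ha1
    have hu := h ((√(sqNorm a))⁻¹ • a) ⟨smul_mem_tangentCone' ha (inv_pos.2 hr), by
      change sqNorm _ = 1
      rw [sqNorm_smul, inv_pow, Real.sq_sqrt hpos.le, inv_mul_cancel₀ hpos.ne']⟩
    rw [dotp_smul_right, abs_mul, abs_of_pos (inv_pos.2 hr), inv_mul_le_iff₀ hr] at hu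
    exact hu.trans (mul_le_of_le_one_left hB hr1)

end GaussianSup

theorem measurePreserving_sumPiEquivProdPi_stdGaussian (ι κ : Type*) [Fintype ι] [Fintype κ] :
    MeasurePreserving (MeasurableEquiv.sumPiEquivProdPi fun _ : ι ⊕ κ => ℝ)
      (stdGaussian (ι ⊕ κ)) ((stdGaussian ι).prod (stdGaussian κ)) :=
  measurePreserving_sumPiEquivProdPi fun _ : ι ⊕ κ => gaussianReal 0 1

/-- **Gaussian complexity bound for the constrained error cone.** -/
theorem gauss_complexity_constrained_cone {n m : ℕ}
    (f : (Fin n → ℝ) → ℝ) (g : (Fin m → ℝ) → ℝ) (hf : IsNorm f) (hg : IsNorm g)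
    (xs : Fin n → ℝ) (vs : Fin m → ℝ)
    (C₁ : Set ((Fin n → ℝ) × (Fin m → ℝ)))
    (hC₁ : C₁ = {p | p.1 ∈ tangentCone' f xs ∧ p.2 ∈ tangentCone' g vs}) :
    gaussComplexity (sphPair C₁) ≤
      2 * (gaussWidth (tangentCone' f xs ∩ unitSphere (Fin n)) +
        gaussWidth (tangentCone' g vs ∩ unitSphere (Fin m)) + 1) := by
  obtain ⟨F, hF, hF0, hFle, hFint⟩ := exists_envelope_abs_dotp
    (Set.inter_subset_right : tangentCone' f xs ∩ unitSphere (Fin n) ⊆ _)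
  obtain ⟨G, hG, hG0, hGle, hGint⟩ := exists_envelope_abs_dotp
    (Set.inter_subset_right : tangentCone' g vs ∩ unitSphere (Fin m) ⊆ _)
  have hmp := measurePreserving_sumPiEquivProdPi_stdGaussian (Fin n) (Fin m)
  have hF' : Integrable (fun p : (Fin n → ℝ) × (Fin m → ℝ) => F p.1)
      ((stdGaussian (Fin n)).prod (stdGaussian (Fin m))) := hF.comp_fst _
  have hG' : Integrable (fun p : (Fin n → ℝ) × (Fin m → ℝ) => G p.2)
      ((stdGaussian (Fin n)).prod (stdGaussian (Fin m))) := hG.comp_snd _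
  let H : (Fin n → ℝ) × (Fin m → ℝ) → ℝ := fun p => F p.1 + G p.2
  have hH : Integrable (fun z => H (MeasurableEquiv.sumPiEquivProdPi (fun _ => ℝ) z))
      (stdGaussian (Fin n ⊕ Fin m)) := hmp.integrable_comp_of_integrable (hF'.add hG')
  have hle : gaussComplexity (sphPair C₁) ≤
      ∫ z, H (MeasurableEquiv.sumPiEquivProdPi (fun _ => ℝ) z)
        ∂(stdGaussian (Fin n ⊕ Fin m)) := by
    refine integral_mono_of_nonneg (Filter.Eventually.of_forall fun z => ?_) hH
      (Filter.Eventually.of_forall fun z => ?_)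
    · refine Real.sSup_nonneg ?_
      rintro _ ⟨x, -, rfl⟩
      exact abs_nonneg _
    · refine Real.sSup_le ?_ (add_nonneg (hF0 _) (hG0 _))
      rintro _ ⟨_, ⟨⟨⟨a, b⟩, hab, rfl⟩, hsph⟩, rfl⟩
      rw [hC₁] at hab
      have hnorm : sqNorm a + sqNorm b = 1 := by
        rw [← show sqNorm (pairVec (a, b)) = 1 from hsph]
        simp [sqNorm, pairVec]
      have hdot : dotp z (pairVec (a, b)) =
          dotp (fun i => z (Sum.inl i)) a + dotp (fun j => z (Sum.inr j)) b := by
        simp [dotp, pairVec]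
      change |dotp z (pairVec (a, b))| ≤ _
      rw [hdot]
      exact (abs_add_le _ _).trans (add_le_add
        (abs_dotp_le_of_mem_tangentCone' (hF0 _) (hFle _) hab.1
          (by linarith [sqNorm_nonneg b]))
        (abs_dotp_le_of_mem_tangentCone' (hG0 _) (hGle _) hab.2
          (by linarith [sqNorm_nonneg a])))
  rw [hmp.integral_comp (MeasurableEquiv.measurableEmbedding _), integral_add hF' hG',
    integral_fun_fst, integral_fun_snd] at hle
  simp only [probReal_univ, one_smul] at hle
  linarith
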